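/- arXiv:2309.02236 — 2 statements merged into one kernel-verified Lean document; each statement's English description precedes it below -/
import Mathlib

section
/- Let S be a measurable space, A a set (of actions), r : S × A → [0, 1], γ ∈ (0, 1), and for i = 1, 2 let 𝒫ᵢ(s, a) be a nonempty set of probability measures on S for every (s, a). Let V₁, V₂ : S → ℝ be bounded measurable and set Qᵢ(s, a) = r(s, a) + γ · inf_{p ∈ 𝒫ᵢ(s, a)} ∫ Vᵢ dp. Suppose there are policies π̂, π* : S → A such that for all s: V₁(s) = Q₁(s, π̂(s)) and Q₁(s, a) ≤ V₁(s) for all a (π̂ is robust-optimal for model 1), and V₂(s) = Q₂(s, π*(s)) and Q₂(s, a) ≤ V₂(s) for all a (π* is robust-optimal for model 2). Then sup_{s ∈ S} |V₁(s) − V₂(s)| ≤ (γ / (1 − γ)) · sup_{(s,a) ∈ S × A} | inf_{p ∈ 𝒫₁(s, a)} ∫ V₂ dp − inf_{p ∈ 𝒫₂(s, a)} ∫ V₂ dp |. -/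
open MeasureTheory

/-- The mean of a bounded function is bounded by the same constant. -/
lemma abs_integral_le_of_abs_le {S : Type*} [MeasurableSpace S] (p : Measure S)
    [IsProbabilityMeasure p] {f : S → ℝ} {C : ℝ} (hC : ∀ s, |f s| ≤ C) :
    |∫ s, f s ∂p| ≤ C := by
  simpa using norm_integral_le_of_norm_le_const (μ := p) (f := f) (C := C) (.of_forall hC)

/-- The robust expectation `inf_{p ∈ U} ∫ f dp` of a bounded measurable function is bounded by the
same constant. -/
lemma abs_iInf_integral_le {S : Type*} [MeasurableSpace S] {U : Set (Measure S)}
    (hne : U.Nonempty) (hp : ∀ p ∈ U, IsProbabilityMeasure p) {f : S → ℝ} {C : ℝ}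
    (hC : ∀ s, |f s| ≤ C) : |⨅ p : U, ∫ s, f s ∂(p : Measure S)| ≤ C := by
  have : Nonempty U := hne.to_subtype
  have hint (p : U) : |∫ s, f s ∂(p : Measure S)| ≤ C := by
    have := hp p p.2
    exact abs_integral_le_of_abs_le _ hC
  have hbdd : BddBelow (Set.range fun p : U => ∫ s, f s ∂(p : Measure S)) :=
    ⟨-C, Set.forall_mem_range.2 fun p => (abs_le.1 (hint p)).1⟩
  let p : U := Classical.arbitrary U
  exact abs_le.2 ⟨le_ciInf fun q => (abs_le.1 (hint q)).1,
    (ciInf_le hbdd p).trans (abs_le.1 (hint p)).2⟩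

/-- The robust expectation is monotone up to additive constants. -/
lemma iInf_integral_le_add {S : Type*} [MeasurableSpace S] {U : Set (Measure S)}
    (hne : U.Nonempty) (hp : ∀ p ∈ U, IsProbabilityMeasure p) {f g : S → ℝ}
    (hf : Measurable f) (hg : Measurable g) {C C' D : ℝ}
    (hC : ∀ s, |f s| ≤ C) (hC' : ∀ s, |g s| ≤ C') (hD : ∀ s, f s ≤ g s + D) :
    (⨅ p : U, ∫ s, f s ∂(p : Measure S)) ≤ (⨅ p : U, ∫ s, g s ∂(p : Measure S)) + D := by
  have : Nonempty U := hne.to_subtype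
  have hbdd : BddBelow (Set.range fun p : U => ∫ s, f s ∂(p : Measure S)) := by
    refine ⟨-C, Set.forall_mem_range.2 fun p => ?_⟩
    have := hp p p.2
    exact (abs_le.1 (abs_integral_le_of_abs_le _ hC)).1
  rw [← sub_le_iff_le_add]
  refine le_ciInf fun p => ?_
  have := hp p p.2
  have hfi : Integrable f (p : Measure S) :=
    .of_bound hf.aestronglyMeasurable C (.of_forall hC)
  have hgi : Integrable g (p : Measure S) :=
    .of_bound hg.aestronglyMeasurable C' (.of_forall hC')
  have h := integral_mono hfi (hgi.add (integrable_const D)) hD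
  simp only [Pi.add_apply] at h
  rw [integral_add hgi (integrable_const D)] at h
  simp only [integral_const, probReal_univ, one_smul] at h
  exact sub_le_iff_le_add.2 ((ciInf_le hbdd p).trans h)

theorem stmt_9 {S : Type*} [MeasurableSpace S] {A : Type*}
    (r : S → A → ℝ) (hr : ∀ s a, r s a ∈ Set.Icc (0 : ℝ) 1)
    (γ : ℝ) (hγ : γ ∈ Set.Ioo (0 : ℝ) 1)
    (U₁ U₂ : S → A → Set (Measure S))
    (hU₁ne : ∀ s a, (U₁ s a).Nonempty) (hU₂ne : ∀ s a, (U₂ s a).Nonempty)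
    (hU₁p : ∀ s a, ∀ p ∈ U₁ s a, IsProbabilityMeasure p)
    (hU₂p : ∀ s a, ∀ p ∈ U₂ s a, IsProbabilityMeasure p)
    (V₁ V₂ : S → ℝ) (hm₁ : Measurable V₁) (hm₂ : Measurable V₂)
    (C₁ C₂ : ℝ) (hb₁ : ∀ s, |V₁ s| ≤ C₁) (hb₂ : ∀ s, |V₂ s| ≤ C₂)
    (Q₁ Q₂ : S → A → ℝ)
    (hQ₁ : ∀ s a, Q₁ s a = r s a + γ * ⨅ p : (U₁ s a), ∫ s', V₁ s' ∂(p : Measure S))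
    (hQ₂ : ∀ s a, Q₂ s a = r s a + γ * ⨅ p : (U₂ s a), ∫ s', V₂ s' ∂(p : Measure S))
    (πhat πstar : S → A)
    (hopt₁ : ∀ s, V₁ s = Q₁ s (πhat s)) (hdom₁ : ∀ s a, Q₁ s a ≤ V₁ s)
    (hopt₂ : ∀ s, V₂ s = Q₂ s (πstar s)) (hdom₂ : ∀ s a, Q₂ s a ≤ V₂ s) :
    (⨆ s, |V₁ s - V₂ s|) ≤ (γ / (1 - γ)) *
      ⨆ q : S × A, |(⨅ p : (U₁ q.1 q.2), ∫ s', V₂ s' ∂(p : Measure S)) -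
                     ⨅ p : (U₂ q.1 q.2), ∫ s', V₂ s' ∂(p : Measure S)| := by
  obtain ⟨hγ0, hγ1⟩ := hγ
  set D := ⨆ s, |V₁ s - V₂ s|
  set E := ⨆ q : S × A, |(⨅ p : (U₁ q.1 q.2), ∫ s', V₂ s' ∂(p : Measure S)) -
    ⨅ p : (U₂ q.1 q.2), ∫ s', V₂ s' ∂(p : Measure S)|
  have hE0 : 0 ≤ E := Real.iSup_nonneg fun _ => abs_nonneg _
  have hD0 : 0 ≤ D := Real.iSup_nonneg fun _ => abs_nonneg _
  have hDle (s : S) : |V₁ s - V₂ s| ≤ D :=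
    le_ciSup (f := fun s => |V₁ s - V₂ s|) ⟨C₁ + C₂, Set.forall_mem_range.2 fun s =>
      (abs_sub _ _).trans (add_le_add (hb₁ s) (hb₂ s))⟩ s
  have hEle (s : S) (a : A) : |(⨅ p : (U₁ s a), ∫ s', V₂ s' ∂(p : Measure S)) -
      ⨅ p : (U₂ s a), ∫ s', V₂ s' ∂(p : Measure S)| ≤ E :=
    le_ciSup (f := fun q : S × A => |(⨅ p : (U₁ q.1 q.2), ∫ s', V₂ s' ∂(p : Measure S)) -
      ⨅ p : (U₂ q.1 q.2), ∫ s', V₂ s' ∂(p : Measure S)|)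
      ⟨C₂ + C₂, Set.forall_mem_range.2 fun q => (abs_sub _ _).trans
        (add_le_add (abs_iInf_integral_le (hU₁ne _ _) (hU₁p _ _) hb₂)
          (abs_iInf_integral_le (hU₂ne _ _) (hU₂p _ _) hb₂))⟩ (s, a)
  have hQ (s : S) (a : A) : |Q₁ s a - Q₂ s a| ≤ γ * (D + E) := by
    have h₁ := iInf_integral_le_add (hU₁ne s a) (hU₁p s a) hm₁ hm₂ hb₁ hb₂ (D := D)
      fun s => by linarith [(abs_le.1 (hDle s)).2]
    have h₂ := iInf_integral_le_add (hU₁ne s a) (hU₁p s a) hm₂ hm₁ hb₂ hb₁ (D := D)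
      fun s => by linarith [(abs_le.1 (hDle s)).1]
    have h₃ := abs_le.1 (hEle s a)
    rw [hQ₁, hQ₂, add_sub_add_left_eq_sub, ← mul_sub, abs_mul, abs_of_pos hγ0]
    exact mul_le_mul_of_nonneg_left (abs_le.2 ⟨by linarith, by linarith⟩) hγ0.le
  have hkey : D ≤ γ * (D + E) := by
    refine Real.iSup_le (fun s => abs_le.2 ⟨?_, ?_⟩) (by positivity)
    · linarith [(abs_le.1 (hQ s (πstar s))).1, hopt₂ s, hdom₁ s (πstar s)]
    · linarith [(abs_le.1 (hQ s (πhat s))).2, hopt₁ s, hdom₂ s (πhat s)]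
  rw [div_mul_eq_mul_div, le_div_iff₀ (by linarith)]
  linarith
end

section
/- Let d ≥ 1, σ > 0, μ₁, μ₂ ∈ ℝ^d, ρ > 0, γ ∈ (0, 1), and let V : ℝ^d → ℝ be measurable with 0 ≤ V(x) ≤ 1/(1 − γ) for all x. Let η ∈ [0, (2 + ρ)/(ρ(1 − γ))]. Then | ∫ (η − V)₊ dN(μ₁, σ²I) − ∫ (η − V)₊ dN(μ₂, σ²I) | ≤ ((2 + ρ)/(ρ(1 − γ))) · ‖μ₁ − μ₂‖ / σ. -/
open MeasureTheory

/-- The isotropic Gaussian measure `N(μ, σ²I)` on `ℝ^d`, as the product over coordinates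
of one-dimensional Gaussian measures with mean `μ i` and variance `σ²`. -/
noncomputable def gaussPi {d : ℕ} (μ : Fin d → ℝ) (σ : ℝ) : Measure (Fin d → ℝ) :=
  Measure.pi fun i => ProbabilityTheory.gaussianReal (μ i) ⟨σ ^ 2, sq_nonneg σ⟩

open ProbabilityTheory
open scoped NNReal

/-- The likelihood ratio of `N(m', v)` with respect to `N(m, v)`. -/
noncomputable def gaussianRatio (m m' : ℝ) (v : ℝ≥0) (x : ℝ) : ℝ :=
  Real.exp ((m' - m) / v * x) * Real.exp (-(m' ^ 2 - m ^ 2) / (2 * v))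

lemma gaussianRatio_nonneg (m m' : ℝ) (v : ℝ≥0) (x : ℝ) : 0 ≤ gaussianRatio m m' v x := by
  unfold gaussianRatio
  positivity

lemma measurable_gaussianRatio (m m' : ℝ) (v : ℝ≥0) : Measurable (gaussianRatio m m' v) := by
  unfold gaussianRatio
  fun_prop

lemma gaussianReal_withDensity_gaussianRatio (m m' : ℝ) {v : ℝ≥0} (hv : v ≠ 0) :
    (gaussianReal m v).withDensity (fun x => ENNReal.ofReal (gaussianRatio m m' v x)) =
      gaussianReal m' v := by
  rw [gaussianReal_of_var_ne_zero _ hv, gaussianReal_of_var_ne_zero _ hv,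
    ← withDensity_mul _ (measurable_gaussianPDF _ _)
      (measurable_gaussianRatio m m' v).ennreal_ofReal]
  congr 1
  ext x
  rw [Pi.mul_apply, gaussianPDF, gaussianPDF, ← ENNReal.ofReal_mul (gaussianPDFReal_nonneg _ _ _),
    gaussianPDFReal, gaussianPDFReal, gaussianRatio, mul_assoc, ← Real.exp_add, ← Real.exp_add]
  have hv' : (v : ℝ) ≠ 0 := by exact_mod_cast hv
  congr 4
  field_simp
  ring

lemma integrable_gaussianRatio (m m' : ℝ) (v : ℝ≥0) :
    Integrable (gaussianRatio m m' v) (gaussianReal m v) :=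
  (integrable_exp_mul_gaussianReal _).mul_const _

lemma gaussianRatio_sq (m m' : ℝ) (v : ℝ≥0) (x : ℝ) :
    gaussianRatio m m' v x ^ 2 =
      Real.exp (2 * ((m' - m) / v) * x) * Real.exp (-(m' ^ 2 - m ^ 2) / v) := by
  rw [gaussianRatio, mul_pow, ← Real.exp_nat_mul, ← Real.exp_nat_mul]
  congr 2 <;> push_cast <;> ring

lemma integrable_gaussianRatio_sq (m m' : ℝ) (v : ℝ≥0) :
    Integrable (fun x => gaussianRatio m m' v x ^ 2) (gaussianReal m v) := by
  simp_rw [gaussianRatio_sq]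
  exact (integrable_exp_mul_gaussianReal _).mul_const _

lemma integral_exp_mul_gaussianReal (m : ℝ) (v : ℝ≥0) (t : ℝ) :
    ∫ x, Real.exp (t * x) ∂(gaussianReal m v) = Real.exp (m * t + v * t ^ 2 / 2) :=
  congrFun (mgf_id_gaussianReal (μ := m) (v := v)) t

lemma integral_gaussianRatio (m m' : ℝ) {v : ℝ≥0} (hv : v ≠ 0) :
    ∫ x, gaussianRatio m m' v x ∂(gaussianReal m v) = 1 := by
  have hv' : (v : ℝ) ≠ 0 := by exact_mod_cast hv
  simp_rw [gaussianRatio]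
  rw [integral_mul_const, integral_exp_mul_gaussianReal, ← Real.exp_add, Real.exp_eq_one_iff]
  field_simp
  ring

lemma integral_gaussianRatio_sq (m m' : ℝ) {v : ℝ≥0} (hv : v ≠ 0) :
    ∫ x, gaussianRatio m m' v x ^ 2 ∂(gaussianReal m v) = Real.exp ((m - m') ^ 2 / v) := by
  have hv' : (v : ℝ) ≠ 0 := by exact_mod_cast hv
  simp_rw [gaussianRatio_sq]
  rw [integral_mul_const, integral_exp_mul_gaussianReal, ← Real.exp_add]
  congr 1
  field_simp
  ring

lemma pi_withDensity_ofReal {ι : Type*} [Fintype ι] {E : ι → Type*}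
    [∀ i, MeasurableSpace (E i)] (μ : ∀ i, Measure (E i)) [∀ i, SigmaFinite (μ i)]
    (f : ∀ i, E i → ℝ) (hf : ∀ i, Integrable (f i) (μ i)) (hf0 : ∀ i x, 0 ≤ f i x) :
    (Measure.pi fun i => (μ i).withDensity fun x => ENNReal.ofReal (f i x)) =
      (Measure.pi μ).withDensity fun x => ENNReal.ofReal (∏ i, f i (x i)) := by
  have : ∀ i, IsFiniteMeasure ((μ i).withDensity fun x => ENNReal.ofReal (f i x)) :=
    fun i => isFiniteMeasure_withDensity_ofReal (hf i).2
  refine Measure.pi_eq fun s hs => ?_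
  rw [withDensity_apply _ (.univ_pi hs), Measure.restrict_pi_pi,
    ← ofReal_integral_eq_lintegral_ofReal
      (Integrable.fintype_prod_dep fun i => (hf i).restrict)
      (ae_of_all _ fun x => Finset.prod_nonneg fun i _ => hf0 i _),
    integral_fintype_prod_eq_prod, ENNReal.ofReal_prod_of_nonneg
      fun i _ => integral_nonneg (hf0 i)]
  refine Finset.prod_congr rfl fun i _ => ?_
  rw [withDensity_apply _ (hs i),
    ofReal_integral_eq_lintegral_ofReal (hf i).restrict (ae_of_all _ (hf0 i))]

/-- A change of measure with density `L` moves the integral of a function with values in `[0, B]`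
by an amount controlled by the chi-square divergence `∫ L² - 1`. -/
lemma abs_integral_sub_integral_mul_le {Ω : Type*} [MeasurableSpace Ω] (P : Measure Ω)
    [IsProbabilityMeasure P] {L f : Ω → ℝ} (hL : Integrable L P)
    (hL2 : Integrable (fun x => L x ^ 2) P) (hL1 : ∫ x, L x ∂P = 1) (hf : Measurable f)
    {B c : ℝ} (hfB : ∀ x, f x ∈ Set.Icc 0 B) (hc : 0 < c) :
    |∫ x, f x ∂P - ∫ x, L x * f x ∂P| ≤
      B / 2 * (c / 2 + ((∫ x, L x ^ 2 ∂P) - 1) / (2 * c)) := by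
  have hfi : Integrable f P :=
    Integrable.of_bound hf.aestronglyMeasurable B (ae_of_all _ fun x => by
      rw [Real.norm_of_nonneg (hfB x).1]; exact (hfB x).2)
  have hLf : Integrable (fun x => L x * f x) P :=
    hL.mul_bdd hf.aestronglyMeasurable (ae_of_all _ fun x => by
      rw [Real.norm_of_nonneg (hfB x).1]; exact (hfB x).2)
  have hd : ∫ x, f x ∂P - ∫ x, L x * f x ∂P = ∫ x, (1 - L x) * (f x - B / 2) ∂P := by
    have h : ∀ x, (1 - L x) * (f x - B / 2) = f x - L x * f x - (1 - L x) * (B / 2) :=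
      fun x => by ring
    simp_rw [h]
    have h1L : Integrable (fun x => 1 - L x) P := (integrable_const 1).sub hL
    have hfLf : Integrable (fun x => f x - L x * f x) P := hfi.sub hLf
    rw [integral_sub hfLf (h1L.mul_const _),
      integral_sub hfi hLf, integral_mul_const, integral_sub (integrable_const 1) hL, hL1]
    simp
  have hsub : Integrable (fun x => L x ^ 2 - 2 * L x) P := hL2.sub (hL.const_mul 2)
  have hadd : Integrable (fun x => L x ^ 2 - 2 * L x + 1) P := hsub.add (integrable_const 1)
  have hg : Integrable (fun x => B / 2 * (c / 2 + (L x ^ 2 - 2 * L x + 1) / (2 * c))) P :=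
    ((integrable_const _).add (hadd.div_const _)).const_mul _
  rw [hd]
  calc |∫ x, (1 - L x) * (f x - B / 2) ∂P|
      ≤ ∫ x, B / 2 * (c / 2 + (L x ^ 2 - 2 * L x + 1) / (2 * c)) ∂P := by
        rw [← Real.norm_eq_abs]
        refine norm_integral_le_of_norm_le hg (ae_of_all _ fun x => ?_)
        obtain ⟨h0, hB⟩ := hfB x
        rw [Real.norm_eq_abs, abs_mul, mul_comm]
        have hfx : |f x - B / 2| ≤ B / 2 := abs_le.2 ⟨by linarith, by linarith⟩
        have hLx : |1 - L x| ≤ c / 2 + (L x ^ 2 - 2 * L x + 1) / (2 * c) := by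
          have hsq : L x ^ 2 - 2 * L x + 1 = |1 - L x| ^ 2 := by rw [sq_abs]; ring
          have hdiff : c / 2 + |1 - L x| ^ 2 / (2 * c) - |1 - L x| =
              (c - |1 - L x|) ^ 2 / (2 * c) := by
            field_simp
            ring
          have : 0 ≤ (c - |1 - L x|) ^ 2 / (2 * c) := by positivity
          rw [hsq]
          linarith
        exact mul_le_mul hfx hLx (abs_nonneg _) (by linarith)
    _ = B / 2 * (c / 2 + ((∫ x, L x ^ 2 ∂P) - 1) / (2 * c)) := by
        rw [integral_const_mul, integral_add (integrable_const _) (hadd.div_const _),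
          integral_div (2 * c), integral_add hsub (integrable_const 1),
          integral_sub hL2 (hL.const_mul 2), integral_const_mul, hL1]
        simp only [integral_const, probReal_univ, one_smul]
        ring

lemma integral_pi_gaussianReal_eq_integral_mul {ι : Type*} [Fintype ι] (μ ν : ι → ℝ) {v : ℝ≥0}
    (hv : v ≠ 0) (f : (ι → ℝ) → ℝ) :
    ∫ x, f x ∂(Measure.pi fun i => gaussianReal (ν i) v) =
      ∫ x, (∏ i, gaussianRatio (μ i) (ν i) v (x i)) * f x
        ∂(Measure.pi fun i => gaussianReal (μ i) v) := by
  have h : (Measure.pi fun i => gaussianReal (ν i) v) =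
      (Measure.pi fun i => gaussianReal (μ i) v).withDensity fun x =>
        ENNReal.ofReal (∏ i, gaussianRatio (μ i) (ν i) v (x i)) := by
    rw [← pi_withDensity_ofReal _ _ (fun i => integrable_gaussianRatio _ _ _)
      fun i => gaussianRatio_nonneg _ _ _]
    simp_rw [gaussianReal_withDensity_gaussianRatio _ _ hv]
  have hm : Measurable fun x : ι → ℝ => ∏ i, gaussianRatio (μ i) (ν i) v (x i) :=
    Finset.measurable_prod _ fun i _ =>
      (measurable_gaussianRatio _ _ _).comp (measurable_pi_apply i)
  rw [h, integral_withDensity_eq_integral_toReal_smul hm.ennreal_ofReal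
    (ae_of_all _ fun _ => ENNReal.ofReal_lt_top)]
  refine integral_congr_ae (ae_of_all _ fun x => ?_)
  simp only [smul_eq_mul]
  rw [ENNReal.toReal_ofReal (Finset.prod_nonneg fun i _ => gaussianRatio_nonneg _ _ _ _)]

lemma abs_integral_pi_gaussianReal_sub_le_chiSq {ι : Type*} [Fintype ι] (μ ν : ι → ℝ) {v : ℝ≥0}
    (hv : v ≠ 0) {f : (ι → ℝ) → ℝ} (hf : Measurable f) {B c : ℝ}
    (hfB : ∀ x, f x ∈ Set.Icc 0 B) (hc : 0 < c) :
    |∫ x, f x ∂(Measure.pi fun i => gaussianReal (μ i) v) -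
        ∫ x, f x ∂(Measure.pi fun i => gaussianReal (ν i) v)| ≤
      B / 2 * (c / 2 + (Real.exp ((∑ i, (μ i - ν i) ^ 2) / v) - 1) / (2 * c)) := by
  rw [integral_pi_gaussianReal_eq_integral_mul μ ν hv]
  have hsq : ∫ x, (∏ i, gaussianRatio (μ i) (ν i) v (x i)) ^ 2
      ∂(Measure.pi fun i => gaussianReal (μ i) v) =
      Real.exp ((∑ i, (μ i - ν i) ^ 2) / v) := by
    simp_rw [← Finset.prod_pow]
    rw [integral_fintype_prod_eq_prod (fun i y => gaussianRatio (μ i) (ν i) v y ^ 2)]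
    simp_rw [integral_gaussianRatio_sq _ _ hv]
    rw [← Real.exp_sum, Finset.sum_div]
  rw [← hsq]
  refine abs_integral_sub_integral_mul_le _ ?_ ?_ ?_ hf hfB hc
  · exact Integrable.fintype_prod_dep fun i => integrable_gaussianRatio _ _ _
  · simp_rw [← Finset.prod_pow]
    exact Integrable.fintype_prod_dep (f := fun i y => gaussianRatio (μ i) (ν i) v y ^ 2)
      fun i => integrable_gaussianRatio_sq _ _ _
  · rw [integral_fintype_prod_eq_prod]
    simp [integral_gaussianRatio _ _ hv]

lemma integral_mem_Icc {Ω : Type*} [MeasurableSpace Ω] (P : Measure Ω) [IsProbabilityMeasure P]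
    {f : Ω → ℝ} {B : ℝ} (hfB : ∀ x, f x ∈ Set.Icc 0 B) : ∫ x, f x ∂P ∈ Set.Icc 0 B := by
  refine ⟨integral_nonneg fun x => (hfB x).1, ?_⟩
  have h := norm_integral_le_of_norm_le_const (μ := P) (f := f) (C := B)
    (ae_of_all _ fun x => by rw [Real.norm_of_nonneg (hfB x).1]; exact (hfB x).2)
  simpa using (le_abs_self _).trans h

lemma abs_integral_pi_gaussianReal_sub_le {ι : Type*} [Fintype ι] (μ ν : ι → ℝ) {v : ℝ≥0}
    (hv : v ≠ 0) {f : (ι → ℝ) → ℝ} (hf : Measurable f) {B : ℝ}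
    (hfB : ∀ x, f x ∈ Set.Icc 0 B) :
    |∫ x, f x ∂(Measure.pi fun i => gaussianReal (μ i) v) -
        ∫ x, f x ∂(Measure.pi fun i => gaussianReal (ν i) v)| ≤
      B * √((∑ i, (μ i - ν i) ^ 2) / v) := by
  have hB : 0 ≤ B := (hfB 0).1.trans (hfB 0).2
  have hS : 0 ≤ ∑ i, (μ i - ν i) ^ 2 := Finset.sum_nonneg fun i _ => sq_nonneg _
  have ht2 : (∑ i, (μ i - ν i) ^ 2) / v = √((∑ i, (μ i - ν i) ^ 2) / v) ^ 2 :=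
    (Real.sq_sqrt (by positivity)).symm
  have ht0 : 0 ≤ √((∑ i, (μ i - ν i) ^ 2) / v) := Real.sqrt_nonneg _
  have hchi := fun c hc => abs_integral_pi_gaussianReal_sub_le_chiSq μ ν hv hf (c := c) hfB hc
  generalize √((∑ i, (μ i - ν i) ^ 2) / v) = t at *
  rw [ht2] at hchi
  rcases eq_or_lt_of_le ht0 with ht | ht
  · have hμν : μ = ν := by
      have hsum : ∑ i, (μ i - ν i) ^ 2 = 0 := by
        rw [← ht, zero_pow two_ne_zero, div_eq_zero_iff] at ht2
        exact ht2.resolve_right (by exact_mod_cast hv)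
      rw [Finset.sum_eq_zero_iff_of_nonneg fun i _ => sq_nonneg _] at hsum
      ext i
      exact sub_eq_zero.1 (pow_eq_zero_iff two_ne_zero |>.1 (hsum i (Finset.mem_univ i)))
    rw [hμν, sub_self, abs_zero]
    positivity
  rcases le_total t 1 with h1 | h1
  · refine (hchi t ht).trans ?_
    have ht1 : t ^ 2 ≤ 1 := pow_le_one₀ ht0 h1
    have hexp : Real.exp (t ^ 2) - 1 ≤ 3 * t ^ 2 := by
      have h := (abs_le.1 (Real.abs_exp_sub_one_sub_id_le (x := t ^ 2)
        (by rwa [abs_of_nonneg (sq_nonneg t)]))).2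
      nlinarith [sq_nonneg t]
    have hdiv : (Real.exp (t ^ 2) - 1) / (2 * t) ≤ 3 / 2 * t := by
      rw [div_le_iff₀ (by positivity)]
      linarith
    nlinarith
  · obtain ⟨hp0, hpB⟩ := integral_mem_Icc (Measure.pi fun i => gaussianReal (μ i) v) hfB
    obtain ⟨hq0, hqB⟩ := integral_mem_Icc (Measure.pi fun i => gaussianReal (ν i) v) hfB
    calc _ ≤ B := abs_le.2 ⟨by linarith, by linarith⟩
      _ ≤ B * t := le_mul_of_one_le_right hB h1

lemma gaussPi_eq_pi_toNNReal {d : ℕ} (μ : Fin d → ℝ) (σ : ℝ) :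
    gaussPi μ σ = Measure.pi fun i => gaussianReal (μ i) (σ ^ 2).toNNReal := by
  rw [Real.toNNReal_of_nonneg (sq_nonneg σ)]
  rfl

theorem stmt_18 {d : ℕ} (hd : 1 ≤ d) (σ : ℝ) (hσ : 0 < σ) (μ₁ μ₂ : Fin d → ℝ)
    (ρ : ℝ) (hρ : 0 < ρ) (γ : ℝ) (hγ : γ ∈ Set.Ioo (0 : ℝ) 1)
    (V : (Fin d → ℝ) → ℝ) (hV : Measurable V)
    (hVb : ∀ x, V x ∈ Set.Icc (0 : ℝ) (1 / (1 - γ)))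
    (η : ℝ) (hη : η ∈ Set.Icc (0 : ℝ) ((2 + ρ) / (ρ * (1 - γ)))) :
    |(∫ x, max (η - V x) 0 ∂(gaussPi μ₁ σ)) -
        ∫ x, max (η - V x) 0 ∂(gaussPi μ₂ σ)| ≤
      ((2 + ρ) / (ρ * (1 - γ))) * (Real.sqrt (∑ i, (μ₁ i - μ₂ i) ^ 2) / σ) := by
  have hv : (σ ^ 2).toNNReal ≠ 0 := (Real.toNNReal_pos.2 (pow_pos hσ 2)).ne'
  have h := abs_integral_pi_gaussianReal_sub_le μ₁ μ₂ hv (f := fun x => max (η - V x) 0)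
    (B := (2 + ρ) / (ρ * (1 - γ))) (by fun_prop) fun x => ⟨le_max_right _ _,
      max_le (by linarith [hη.2, (hVb x).1]) (hη.1.trans hη.2)⟩
  rwa [Real.coe_toNNReal _ (sq_nonneg σ), Real.sqrt_div' _ (sq_nonneg σ), Real.sqrt_sq hσ.le,
    ← gaussPi_eq_pi_toNNReal, ← gaussPi_eq_pi_toNNReal] at h
end
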